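/- arXiv:2605.09669 — 9 statements merged into one kernel-verified Lean document; each statement's English description precedes it below -/
import Mathlib

section
/- Let Δx > 0, ν ∈ ℝ, and let Q, q₋, q₊ be real numbers. Define q_recon : ℝ → ℝ by q_recon(ξ) = (6Q − q₊ − q₋)/4 + ((q₊ − q₋)/Δx)·ξ + 3((q₋ + q₊ − 2Q)/Δx²)·ξ². Then the Simpson-rule time average (1/6)·( q_recon(Δx/2) + 4·q_recon(Δx/2 − ν·Δx/2) + q_recon(Δx/2 − ν·Δx) ) equals Q + (1 − ν)·( (1 − ν)·(q₊ − Q) + ν·(Q − q₋) ). -/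
/-- The third-order Active Flux reconstruction polynomial on the reference cell
`[-Δx/2, Δx/2]` with cell average `Q` and interface point values `qm` (left) and `qp` (right). -/
noncomputable def qRecon (Δx Q qm qp : ℝ) : ℝ → ℝ := fun ξ =>
  (6 * Q - qp - qm) / 4 + ((qp - qm) / Δx) * ξ + 3 * ((qm + qp - 2 * Q) / Δx ^ 2) * ξ ^ 2

theorem simpson_time_average (Δx ν Q qm qp : ℝ) (hΔx : 0 < Δx) :
    (1 / 6) * (qRecon Δx Q qm qp (Δx / 2) + 4 * qRecon Δx Q qm qp (Δx / 2 - ν * Δx / 2)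
        + qRecon Δx Q qm qp (Δx / 2 - ν * Δx)) =
      Q + (1 - ν) * ((1 - ν) * (qp - Q) + ν * (Q - qm)) := by
  have h : Δx ≠ 0 := hΔx.ne'
  simp only [qRecon]
  field_simp
  ring
end

section
/- Let ν ∈ (0,1) and R, S, T, U > 0. Then det( A(ν,θ;R,S,T,U) − e^{−Iνθ}·Id ) = O(θ²) as θ → 0. (Equivalently, the principal eigenvalue of A matches the exact amplification factor e^{−Iνθ} at least to first order in θ, for every choice of the positive parameters.) -/
open Complex Matrix

/-- The amplification matrix of the parameterized Active Flux scheme. -/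
noncomputable def ampMatrix (ν θ R S T U : ℝ) : Matrix (Fin 2) (Fin 2) ℂ :=
  !![1 - (ν : ℂ) * (1 + (1 - (ν : ℂ)) * ((U : ℂ) - (T : ℂ))) *
        (1 - Complex.exp (-Complex.I * (θ : ℂ))),
      (ν : ℂ) * (1 - (ν : ℂ)) * ((U : ℂ) * Complex.exp (-Complex.I * (θ : ℂ)) - (T : ℂ)) *
        (1 - Complex.exp (-Complex.I * (θ : ℂ)));
      (ν : ℂ) * (1 - (ν : ℂ)) * ((R : ℂ) + (S : ℂ)),
      (1 - (ν : ℂ)) * (1 - (ν : ℂ) * (R : ℂ)) +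
        (ν : ℂ) * (1 - (1 - (ν : ℂ)) * (S : ℂ)) * Complex.exp (-Complex.I * (θ : ℂ))]

open Asymptotics Filter Topology in
/-- Second-order Taylor remainder of `exp` along the line `θ ↦ c * θ`. -/
lemma exp_mul_ofReal_sub_one_sub_isBigO (c : ℂ) :
    (fun θ : ℝ => Complex.exp (c * θ) - 1 - c * θ) =O[𝓝 0] fun θ : ℝ => θ ^ 2 := by
  have hlim : Tendsto (fun θ : ℝ => c * (θ : ℂ)) (𝓝 0) (𝓝 0) :=
    Continuous.tendsto' (by fun_prop) _ _ (by simp)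
  have hexp := (Complex.exp_sub_sum_range_isBigO_pow 2).comp_tendsto hlim
  have hsq : (fun θ : ℝ => (c * (θ : ℂ)) ^ 2) =O[𝓝 0] fun θ : ℝ => θ ^ 2 :=
    .of_bound (‖c‖ ^ 2) (.of_forall fun θ => by simp [mul_pow])
  refine (hexp.trans hsq).congr_left fun θ => ?_
  simp [Finset.sum_range_succ, sub_sub]

open Asymptotics Filter Topology in
lemma one_sub_exp_mul_ofReal_isBigO (c : ℂ) :
    (fun θ : ℝ => 1 - Complex.exp (c * θ)) =O[𝓝 0] fun θ : ℝ => θ := by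
  have hsq : (fun θ : ℝ => θ ^ 2) =O[𝓝 0] fun θ : ℝ => θ := by
    simpa using (isLittleO_pow_pow (𝕜 := ℝ) one_lt_two).isBigO
  have hlin : (fun θ : ℝ => c * (θ : ℂ)) =O[𝓝 0] fun θ : ℝ => θ :=
    .of_bound ‖c‖ (.of_forall fun θ => by simp)
  refine (((exp_mul_ofReal_sub_one_sub_isBigO c).trans hsq).add hlin).neg_left.congr_left
    fun θ => ?_
  ring

/-- With `E = 1 - e^{-Iθ}`, the characteristic polynomial of the amplification matrix at `q` is a
multiple of `1 - q - ν E` plus a multiple of `E ^ 2`. -/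
lemma det_ampMatrix_sub_smul_one (ν θ R S T U : ℝ) (q : ℂ) :
    Matrix.det (ampMatrix ν θ R S T U - q • (1 : Matrix (Fin 2) (Fin 2) ℂ)) =
      (1 - q - ν * (1 - Complex.exp (-Complex.I * θ))) *
        ((1 - ν) * (1 - ν * R) + ν * (1 - (1 - ν) * S) * Complex.exp (-Complex.I * θ) - q -
          ν * (1 - ν) * (U - T) * (1 - Complex.exp (-Complex.I * θ))) +
      (ν * (1 - ν)) ^ 2 * (R * U + S * T) * (1 - Complex.exp (-Complex.I * θ)) ^ 2 := by
  simp [Matrix.det_fin_two, ampMatrix]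
  ring

open Asymptotics Filter Topology in
theorem principal_eigenvalue_first_order_correct (ν R S T U : ℝ)
    (hν : ν ∈ Set.Ioo (0 : ℝ) 1) (hR : 0 < R) (hS : 0 < S) (hT : 0 < T) (hU : 0 < U) :
    (fun θ : ℝ => Matrix.det (ampMatrix ν θ R S T U -
        Complex.exp (-Complex.I * (ν : ℂ) * (θ : ℂ)) • (1 : Matrix (Fin 2) (Fin 2) ℂ)))
      =O[𝓝 0] fun θ : ℝ => θ ^ 2 := by
  have hres : (fun θ : ℝ => 1 - Complex.exp (-Complex.I * ν * θ) -
      ν * (1 - Complex.exp (-Complex.I * θ))) =O[𝓝 0] fun θ : ℝ => θ ^ 2 := by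
    refine (((exp_mul_ofReal_sub_one_sub_isBigO (-Complex.I)).const_mul_left (ν : ℂ)).sub
      (exp_mul_ofReal_sub_one_sub_isBigO (-Complex.I * ν))).congr_left fun θ => ?_
    ring
  have hbdd : (fun θ : ℝ => (1 - ν) * (1 - ν * R) +
      ν * (1 - (1 - ν) * S) * Complex.exp (-Complex.I * θ) - Complex.exp (-Complex.I * ν * θ) -
      ν * (1 - ν) * (U - T) * (1 - Complex.exp (-Complex.I * θ))) =O[𝓝 0]
      fun _ : ℝ => (1 : ℝ) :=
    (Continuous.tendsto (by fun_prop) 0).isBigO_one ℝ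
  have hsq := ((one_sub_exp_mul_ofReal_isBigO (-Complex.I)).pow 2).const_mul_left
    (((ν : ℂ) * (1 - ν)) ^ 2 * (R * U + S * T))
  simp only [det_ampMatrix_sub_smul_one]
  exact ((hres.mul hbdd).congr_right fun θ => mul_one _).add hsq
end

section
/- Let ν ∈ (0,1), R, S > 0, and set T = −(1/3)(ν+1)R + R²/(R+S) + 1/2 and U = (1/6)·( 2S·(ν − 3R/(R+S) + 1) + 3 ). Then det( A(ν,θ;R,S,T,U) − e^{−Iνθ}·Id ) = O(θ⁴) as θ → 0, i.e., the principal eigenvalue of A agrees with e^{−Iνθ} to third order in θ. -/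
open Complex Matrix

open Asymptotics Filter Topology in
lemma cexp_mul_ofReal_sub_taylor_isBigO (z : ℂ) :
    (fun θ : ℝ => Complex.exp (z * θ) -
        (1 + z * θ + (z * θ) ^ 2 / 2 + (z * θ) ^ 3 / 6)) =O[𝓝 0] fun θ : ℝ => θ ^ 4 := by
  have hlim : Tendsto (fun θ : ℝ => z * (θ : ℂ)) (𝓝 0) (𝓝 0) := by
    have hcont : Continuous fun θ : ℝ => z * (θ : ℂ) := by fun_prop
    simpa using hcont.tendsto 0
  have hexp := (Complex.exp_sub_sum_range_isBigO_pow 4).comp_tendsto hlim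
  have hpow : (fun θ : ℝ => (z * (θ : ℂ)) ^ 4) =O[𝓝 0] fun θ : ℝ => θ ^ 4 :=
    IsBigO.of_bound (‖z‖ ^ 4) (Eventually.of_forall fun θ => by simp [mul_pow])
  refine (hexp.trans hpow).congr_left fun θ => ?_
  simp [Finset.sum_range_succ, Nat.factorial]

/-- The determinant as a combination of exponentials, reduced by their cubic Taylor polynomials:
the order conditions on `T` and `U` make the combination of these polynomials vanish.
Here `k = R / (R + S)`, `x` stands for `-I * θ` and `e`, `E` for the exponentials
of `x` and `ν * x`. -/
lemma det_sub_smul_eq_taylor_remainders {ν R S T U k e E x : ℂ} (hk : k * (R + S) = R)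
    (hT : T = -(1 / 3) * (ν + 1) * R + R * k + 1 / 2)
    (hU : U = (1 / 6) * (2 * S * (ν - 3 * k + 1) + 3)) :
    (1 - ν * (1 + (1 - ν) * (U - T)) * (1 - e) - E) *
          ((1 - ν) * (1 - ν * R) + ν * (1 - (1 - ν) * S) * e - E) -
        ν * (1 - ν) * (U * e - T) * (1 - e) * (ν * (1 - ν) * (R + S)) =
      (E ^ 2 - (1 + 2 * ν * x + (2 * ν * x) ^ 2 / 2 + (2 * ν * x) ^ 3 / 6)) -
      (ν * (1 + (1 - ν) * (U - T)) + ν * (1 - (1 - ν) * S)) *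
        (e * E - (1 + (1 + ν) * x + ((1 + ν) * x) ^ 2 / 2 + ((1 + ν) * x) ^ 3 / 6)) +
      (ν * (1 + (1 - ν) * (U - T)) * (ν * (1 - (1 - ν) * S)) +
          ν ^ 2 * (1 - ν) ^ 2 * (R + S) * U) *
        (e ^ 2 - (1 + 2 * x + (2 * x) ^ 2 / 2 + (2 * x) ^ 3 / 6)) -
      (1 - ν * (1 + (1 - ν) * (U - T)) + (1 - ν) * (1 - ν * R)) *
        (E - (1 + ν * x + (ν * x) ^ 2 / 2 + (ν * x) ^ 3 / 6)) +
      ((1 - ν * (1 + (1 - ν) * (U - T))) * (ν * (1 - (1 - ν) * S)) +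
          ν * (1 + (1 - ν) * (U - T)) * ((1 - ν) * (1 - ν * R)) -
          ν ^ 2 * (1 - ν) ^ 2 * (R + S) * (U + T)) *
        (e - (1 + x + x ^ 2 / 2 + x ^ 3 / 6)) := by
  obtain ⟨s, hs⟩ : ∃ s, s = R + S := ⟨_, rfl⟩
  rw [← hs] at hk
  obtain rfl : S = s - R := by rw [hs]; ring
  subst hT hU hk
  ring

open Asymptotics Filter Topology in
theorem principal_eigenvalue_third_order_correct (ν R S : ℝ)
    (hν : ν ∈ Set.Ioo (0 : ℝ) 1) (hR : 0 < R) (hS : 0 < S) :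
    (fun θ : ℝ => Matrix.det (ampMatrix ν θ R S
        (-(1 / 3) * (ν + 1) * R + R ^ 2 / (R + S) + 1 / 2)
        ((1 / 6) * (2 * S * (ν - 3 * R / (R + S) + 1) + 3)) -
        Complex.exp (-Complex.I * (ν : ℂ) * (θ : ℂ)) • (1 : Matrix (Fin 2) (Fin 2) ℂ)))
      =O[𝓝 0] fun θ : ℝ => θ ^ 4 := by
  have hRS : (R : ℂ) + S ≠ 0 := by exact_mod_cast (add_pos hR hS).ne'
  set T : ℝ := -(1 / 3) * (ν + 1) * R + R ^ 2 / (R + S) + 1 / 2 with hT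
  set U : ℝ := (1 / 6) * (2 * S * (ν - 3 * R / (R + S) + 1) + 3) with hU
  have hTc : (T : ℂ) = -(1 / 3) * (ν + 1) * R + R * (R / (R + S)) + 1 / 2 := by
    rw [hT]; push_cast; ring
  have hUc : (U : ℂ) = (1 / 6) * (2 * S * (ν - 3 * (R / (R + S)) + 1) + 3) := by
    rw [hU]; push_cast; ring
  have taylor := cexp_mul_ofReal_sub_taylor_isBigO
  refine IsBigO.congr_left
    (((((taylor (-I * (2 * ν))).sub
      ((taylor (-I * (1 + ν))).const_mul_left
        (ν * (1 + (1 - ν) * (U - T)) + ν * (1 - (1 - ν) * S)))).add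
      ((taylor (-I * 2)).const_mul_left
        (ν * (1 + (1 - ν) * (U - T)) * (ν * (1 - (1 - ν) * S)) +
          ν ^ 2 * (1 - ν) ^ 2 * (R + S) * U))).sub
      ((taylor (-I * ν)).const_mul_left
        (1 - ν * (1 + (1 - ν) * (U - T)) + (1 - ν) * (1 - ν * R)))).add
      ((taylor (-I)).const_mul_left
        ((1 - ν * (1 + (1 - ν) * (U - T))) * (ν * (1 - (1 - ν) * S)) +
          ν * (1 + (1 - ν) * (U - T)) * ((1 - ν) * (1 - ν * R)) -
          ν ^ 2 * (1 - ν) ^ 2 * (R + S) * (U + T)))) fun θ => ?_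
  have hE2 : exp (-I * (2 * ν) * θ) = exp (-I * ν * θ) ^ 2 := by
    rw [← Complex.exp_nat_mul]; congr 1; push_cast; ring
  have heE : exp (-I * (1 + ν) * θ) = exp (-I * θ) * exp (-I * ν * θ) := by
    rw [← Complex.exp_add]; congr 1; ring
  have he2 : exp (-I * 2 * θ) = exp (-I * θ) ^ 2 := by
    rw [← Complex.exp_nat_mul]; congr 1; push_cast; ring
  have key := det_sub_smul_eq_taylor_remainders (e := exp (-I * θ)) (E := exp (-I * ν * θ))
    (x := -I * θ) (div_mul_cancel₀ (R : ℂ) hRS) hTc hUc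
  rw [hE2, heE, he2, Matrix.det_fin_two]
  simp only [ampMatrix, Matrix.sub_apply, Matrix.smul_apply, Matrix.of_apply, Matrix.cons_val',
    Matrix.cons_val_zero, Matrix.cons_val_one, Matrix.cons_val_fin_one, Matrix.one_apply_eq,
    Matrix.one_apply_ne zero_ne_one, Matrix.one_apply_ne one_ne_zero, smul_eq_mul, mul_one,
    mul_zero, sub_zero]
  rw [key]
  ring
end

section
/- Let ν ∈ (0,1), R, S > 0, and set T = −(1/3)(ν+1)R + R²/(R+S) + 1/2 and U = (1/6)·( 2S·(ν − 3R/(R+S) + 1) + 3 ). Then there exist ε > 0, C > 0 and a function λ₁ : (−ε,ε) → ℂ such that for all θ ∈ (−ε,ε), λ₁(θ) is an eigenvalue of A(ν,θ;R,S,T,U) and | λ₁(θ) − e^{−Iνθ} − (1/72)·(ν−1)·ν·( (ν−2)(ν+1) + 18/(R+S) )·θ⁴ | ≤ C·|θ|⁵. -/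
open Complex Matrix

open Asymptotics Filter Topology

/-- A monic quadratic whose root sum stays at distance `2 * δ` from `2 * w` has a root close
to `w` whenever it almost vanishes at `w`. -/
lemma exists_quadratic_root_near (t d w : ℂ) {δ : ℝ} (hδ : 0 < δ) (h : 2 * δ ≤ ‖2 * w - t‖) :
    ∃ l : ℂ, l ^ 2 - t * l + d = 0 ∧ ‖l - w‖ ≤ ‖w ^ 2 - t * w + d‖ / δ := by
  obtain ⟨s, hs⟩ := IsAlgClosed.exists_pow_nat_eq (t ^ 2 - 4 * d) (n := 2) two_pos
  have near : ∀ r : ℂ, r ^ 2 = t ^ 2 - 4 * d → δ ≤ ‖w - (t - r) / 2‖ →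
      ∃ l : ℂ, l ^ 2 - t * l + d = 0 ∧ ‖l - w‖ ≤ ‖w ^ 2 - t * w + d‖ / δ := by
    intro r hr hfar
    refine ⟨(t + r) / 2, by linear_combination hr / 4, ?_⟩
    rw [le_div_iff₀ hδ]
    calc ‖(t + r) / 2 - w‖ * δ ≤ ‖(t + r) / 2 - w‖ * ‖w - (t - r) / 2‖ := by gcongr
      _ = ‖w ^ 2 - t * w + d‖ := by
        rw [← norm_mul, ← norm_neg]
        congr 1
        linear_combination -hr / 4
  by_cases hfar : δ ≤ ‖w - (t - s) / 2‖
  · exact near s hs hfar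
  · refine near (-s) (by rw [neg_sq, hs]) ?_
    have htri := norm_add_le (w - (t - s) / 2) (w - (t - -s) / 2)
    rw [show w - (t - s) / 2 + (w - (t - -s) / 2) = 2 * w - t by ring] at htri
    linarith

/-- A quadratic expression in `x` and `w`, monic in `w`, changes by `O(g)` when its arguments
change by `O(g)`. -/
lemma isBigO_quadratic_sub {α : Type*} {l : Filter α} {x x' w w' : α → ℂ} {g : α → ℝ}
    {X X' W W' : ℂ} (hx : Tendsto x l (𝓝 X)) (hx' : Tendsto x' l (𝓝 X'))
    (hw : Tendsto w l (𝓝 W)) (hw' : Tendsto w' l (𝓝 W'))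
    (hxx : (fun a => x a - x' a) =O[l] g) (hww : (fun a => w a - w' a) =O[l] g)
    (t₀ t₁ d₀ d₁ d₂ : ℂ) :
    (fun a => (w a ^ 2 - (t₀ + t₁ * x a) * w a + (d₀ + d₁ * x a + d₂ * x a ^ 2)) -
      (w' a ^ 2 - (t₀ + t₁ * x' a) * w' a + (d₀ + d₁ * x' a + d₂ * x' a ^ 2))) =O[l] g := by
  have hA : (fun a => d₁ + d₂ * (x a + x' a) - t₁ * w a) =O[l] (fun _ => (1 : ℝ)) :=
    Tendsto.isBigO_one ℝ
      ((tendsto_const_nhds.add ((hx.add hx').const_mul d₂)).sub (hw.const_mul t₁))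
  have hB : (fun a => w a + w' a - (t₀ + t₁ * x' a)) =O[l] (fun _ => (1 : ℝ)) :=
    Tendsto.isBigO_one ℝ ((hw.add hw').sub (tendsto_const_nhds.add (hx'.const_mul t₁)))
  have h := (hxx.mul hA).add (hww.mul hB)
  simp only [mul_one] at h
  refine h.congr_left fun a => ?_
  ring

/-- The characteristic polynomial of the amplification matrix, evaluated at the truncated
expansion of the principal eigenvalue, vanishes to fifth order. -/
lemma ampMatrix_charpoly_expansion (ν R S : ℂ) (hK : R + S ≠ 0) :
    ∃ G : ℂ → ℂ, Continuous G ∧ ∀ z T U x w : ℂ,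
      T = -(1 / 3) * (ν + 1) * R + R ^ 2 / (R + S) + 1 / 2 →
      U = (1 / 6) * (2 * S * (ν - 3 * R / (R + S) + 1) + 3) →
      x = 1 + z + z ^ 2 / 2 + z ^ 3 / 6 + z ^ 4 / 24 →
      w = 1 + ν * z + (ν * z) ^ 2 / 2 + (ν * z) ^ 3 / 6 + (ν * z) ^ 4 / 24 +
        (1 / 72) * (ν - 1) * ν * ((ν - 2) * (ν + 1) + 18 / (R + S)) * z ^ 4 →
      (1 - ν * (1 + (1 - ν) * (U - T)) * (1 - x) - w) *
          ((1 - ν) * (1 - ν * R) + ν * (1 - (1 - ν) * S) * x - w) -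
        ν * (1 - ν) * (U * x - T) * (1 - x) * (ν * (1 - ν) * (R + S)) = z ^ 5 * G z := by
  obtain ⟨K, rfl⟩ : ∃ K, S = K - R := ⟨R + S, by ring⟩
  rw [add_sub_cancel] at *
  refine ⟨fun z =>
      ((1/216) * ν ^ 2 * K + (1/4) * ν ^ 3 + (-5/216) * ν ^ 3 * K + (-1/2) * ν ^ 4 +
        (7/216) * ν ^ 4 * K + (1/4) * ν ^ 5 + (1/216) * ν ^ 5 * K + (-1/27) * ν ^ 6 * K +
        (1/54) * ν ^ 7 * K) +
      ((1/4) * ν ^ 2 * K⁻¹ + (-1/24) * ν ^ 2 + (-1/432) * ν ^ 2 * K + (-1/2) * ν ^ 3 * K⁻¹ +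
        (5/24) * ν ^ 3 + (-1/216) * ν ^ 3 * K + (1/4) * ν ^ 4 * K⁻¹ + (-5/24) * ν ^ 4 +
        (5/432) * ν ^ 4 * K + (-1/24) * ν ^ 5 + (1/108) * ν ^ 5 * K + (1/12) * ν ^ 6 +
        (-5/216) * ν ^ 6 * K + (1/108) * ν ^ 7 * K) * z +
      ((1/12) * ν ^ 2 * K⁻¹ + (-5/216) * ν ^ 2 + (1/1296) * ν ^ 2 * K + (-1/12) * ν ^ 3 * K⁻¹ +
        (2/27) * ν ^ 3 + (-1/162) * ν ^ 3 * K + (-1/12) * ν ^ 4 * K⁻¹ + (-11/216) * ν ^ 4 +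
        (5/648) * ν ^ 4 * K + (1/12) * ν ^ 5 * K⁻¹ + (-1/108) * ν ^ 5 + (1/324) * ν ^ 5 * K +
        (-1/108) * ν ^ 6 + (-11/1296) * ν ^ 6 * K + (1/54) * ν ^ 7 +
        (1/324) * ν ^ 7 * K) * z ^ 2 +
      ((1/16) * ν ^ 2 * K⁻¹ ^ 2 + (1/144) * ν ^ 2 * K⁻¹ + (-35/5184) * ν ^ 2 +
        (5/10368) * ν ^ 2 * K + (-1/8) * ν ^ 3 * K⁻¹ ^ 2 + (23/1296) * ν ^ 3 +
        (-1/648) * ν ^ 3 * K + (1/16) * ν ^ 4 * K⁻¹ ^ 2 + (1/144) * ν ^ 4 * K⁻¹ +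
        (-67/5184) * ν ^ 4 + (5/10368) * ν ^ 4 * K + (-1/24) * ν ^ 5 * K⁻¹ + (7/2592) * ν ^ 5 +
        (13/5184) * ν ^ 5 * K + (1/36) * ν ^ 6 * K⁻¹ + (-1/1296) * ν ^ 6 +
        (-7/2592) * ν ^ 6 * K + (-1/324) * ν ^ 7 + (1/1296) * ν ^ 7 * K +
        (1/324) * ν ^ 8) * z ^ 3, by fun_prop, ?_⟩
  rintro z T U x w rfl rfl rfl rfl
  field_simp
  ring

lemma isBigO_exp_mul_sub_taylor (a : ℂ) :
    (fun θ : ℝ => Complex.exp (a * θ) - (1 + a * θ + (a * θ) ^ 2 / 2 + (a * θ) ^ 3 / 6 +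
      (a * θ) ^ 4 / 24)) =O[𝓝 0] (fun θ : ℝ => θ ^ 5) := by
  have hlim : Tendsto (fun θ : ℝ => a * (θ : ℂ)) (𝓝 0) (𝓝 0) := by
    have : Continuous fun θ : ℝ => a * (θ : ℂ) := by fun_prop
    simpa using this.tendsto 0
  have h := (Complex.exp_sub_sum_range_isBigO_pow 5).comp_tendsto hlim
  have hpow : (fun θ : ℝ => (a * (θ : ℂ)) ^ 5) =O[𝓝 0] (fun θ : ℝ => θ ^ 5) := by
    refine IsBigO.of_bound (‖a‖ ^ 5) (Eventually.of_forall fun θ => ?_)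
    simp [mul_pow]
  refine (h.trans hpow).congr_left fun θ => ?_
  simp [Finset.sum_range_succ, Nat.factorial]

theorem principal_eigenvalue_error_third_order (ν R S : ℝ)
    (hν : ν ∈ Set.Ioo (0 : ℝ) 1) (hR : 0 < R) (hS : 0 < S) :
    ∃ ε > (0 : ℝ), ∃ C > (0 : ℝ), ∃ lam : ℝ → ℂ,
      ∀ θ ∈ Set.Ioo (-ε) ε,
        Matrix.det (ampMatrix ν θ R S
            (-(1 / 3) * (ν + 1) * R + R ^ 2 / (R + S) + 1 / 2)
            ((1 / 6) * (2 * S * (ν - 3 * R / (R + S) + 1) + 3)) -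
          lam θ • (1 : Matrix (Fin 2) (Fin 2) ℂ)) = 0 ∧
        ‖lam θ - Complex.exp (-Complex.I * (ν : ℂ) * (θ : ℂ)) -
            (((1 / 72) * (ν - 1) * ν * ((ν - 2) * (ν + 1) + 18 / (R + S)) : ℝ) : ℂ) *
              (θ : ℂ) ^ 4‖ ≤ C * |θ| ^ 5 := by
  obtain ⟨hν0, hν1⟩ := hν
  have hK : (R : ℂ) + S ≠ 0 := by exact_mod_cast (add_pos hR hS).ne'
  set T : ℝ := -(1 / 3) * (ν + 1) * R + R ^ 2 / (R + S) + 1 / 2 with hT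
  set U : ℝ := (1 / 6) * (2 * S * (ν - 3 * R / (R + S) + 1) + 3) with hU
  set c : ℝ := (1 / 72) * (ν - 1) * ν * ((ν - 2) * (ν + 1) + 18 / (R + S)) with hc
  obtain ⟨G, hG, hGeq⟩ := ampMatrix_charpoly_expansion ν R S hK
  set x : ℝ → ℂ := fun θ => exp (-I * θ) with hx
  set w : ℝ → ℂ := fun θ => exp (-I * ν * θ) + c * (θ : ℂ) ^ 4 with hw
  set x' : ℝ → ℂ := fun θ => 1 + -I * θ + (-I * θ) ^ 2 / 2 + (-I * θ) ^ 3 / 6 +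
    (-I * θ) ^ 4 / 24 with hx'
  set w' : ℝ → ℂ := fun θ => 1 + -I * ν * θ + (-I * ν * θ) ^ 2 / 2 + (-I * ν * θ) ^ 3 / 6 +
    (-I * ν * θ) ^ 4 / 24 + c * (θ : ℂ) ^ 4 with hw'
  have hxc : Continuous x := by fun_prop
  have hwc : Continuous w := by fun_prop
  have hxc' : Continuous x' := by fun_prop
  have hwc' : Continuous w' := by fun_prop
  have hxx : (fun θ => x θ - x' θ) =O[𝓝 0] (fun θ : ℝ => θ ^ 5) :=
    isBigO_exp_mul_sub_taylor (-I)
  have hww : (fun θ => w θ - w' θ) =O[𝓝 0] (fun θ : ℝ => θ ^ 5) :=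
    (isBigO_exp_mul_sub_taylor (-I * ν)).congr_left fun θ => by simp only [hw, hw']; ring
  set α : ℂ := ν * (1 + (1 - ν) * (U - T)) with hα
  set β : ℂ := (1 - ν) * (1 - ν * R) with hβ
  set γ : ℂ := ν * (1 - (1 - ν) * S) with hγ
  set κ : ℂ := ν * (1 - ν) * (R + S) with hκ
  set μ : ℂ := ν * (1 - ν) with hμ
  set tr : ℝ → ℂ := fun θ => (1 - α + β) + (α + γ) * x θ with htr
  set dt : ℝ → ℂ := fun θ => ((1 - α) * β + μ * T * κ) +
    ((1 - α) * γ + α * β - μ * (U + T) * κ) * x θ + (α * γ + μ * U * κ) * x θ ^ 2 with hdt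
  have hdet : ∀ θ l, det (ampMatrix ν θ R S T U - l • (1 : Matrix (Fin 2) (Fin 2) ℂ)) =
      l ^ 2 - tr θ * l + dt θ := by
    intro θ l
    simp [ampMatrix, det_fin_two, htr, hdt, hα, hβ, hγ, hκ, hμ, hx]
    ring
  have htrunc : (fun θ => w' θ ^ 2 - ((1 - α + β) + (α + γ) * x' θ) * w' θ +
      (((1 - α) * β + μ * T * κ) + ((1 - α) * γ + α * β - μ * (U + T) * κ) * x' θ +
        (α * γ + μ * U * κ) * x' θ ^ 2)) =O[𝓝 0] (fun θ : ℝ => θ ^ 5) := by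
    have hGO : (fun θ : ℝ => G (-I * θ)) =O[𝓝 0] (fun _ => (1 : ℝ)) :=
      Tendsto.isBigO_one ℝ ((show Continuous fun θ : ℝ => G (-I * θ) by fun_prop).tendsto 0)
    have hpow : (fun θ : ℝ => (-I * (θ : ℂ)) ^ 5) =O[𝓝 0] (fun θ : ℝ => θ ^ 5) :=
      IsBigO.of_bound 1 (Eventually.of_forall fun θ => by simp)
    have h := hpow.mul hGO
    simp only [mul_one] at h
    refine h.congr_left fun θ => ?_
    rw [← hGeq (-I * θ) T U (x' θ) (w' θ) (by simp [hT]) (by simp [hU]) rfl]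
    · simp only [hα, hβ, hγ, hκ, hμ]
      ring
    · simp only [hw', hc]
      push_cast
      have hI : (-I * (θ : ℂ)) ^ 4 = (θ : ℂ) ^ 4 := by
        rw [mul_pow, neg_pow, I_pow_four]; ring
      rw [hI]
      ring
  have hres : (fun θ => w θ ^ 2 - tr θ * w θ + dt θ) =O[𝓝 0] (fun θ : ℝ => θ ^ 5) :=
    ((isBigO_quadratic_sub (hxc.tendsto 0) (hxc'.tendsto 0) (hwc.tendsto 0) (hwc'.tendsto 0)
      hxx hww _ _ _ _ _).add htrunc).congr_left fun θ => sub_add_cancel _ _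
  set k : ℝ := ν * (1 - ν) * (R + S) with hk
  have hkpos : 0 < k := mul_pos (mul_pos hν0 (sub_pos.2 hν1)) (add_pos hR hS)
  have hgap : ∀ᶠ θ in 𝓝 (0 : ℝ), 2 * (k / 4) ≤ ‖2 * w θ - tr θ‖ := by
    have hcont : Continuous fun θ => ‖2 * w θ - tr θ‖ := by fun_prop
    have h0 : ‖2 * w 0 - tr 0‖ = k := by
      have : 2 * w 0 - tr 0 = (k : ℂ) := by
        simp [hw, htr, hx, hα, hβ, hγ, hk]
        ring
      rw [this, norm_real, Real.norm_of_nonneg hkpos.le]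
    have hlt : 2 * (k / 4) < ‖2 * w 0 - tr 0‖ := by rw [h0]; linarith
    exact (hcont.tendsto 0).eventually (eventually_ge_nhds hlt)
  obtain ⟨C, hCpos, hC⟩ := hres.exists_pos
  obtain ⟨ε, hε, hball⟩ := Metric.eventually_nhds_iff.1 (hgap.and hC.bound)
  have hex : ∀ θ : ℝ, ∃ l : ℂ, θ ∈ Set.Ioo (-ε) ε → l ^ 2 - tr θ * l + dt θ = 0 ∧
      ‖l - w θ‖ ≤ C / (k / 4) * |θ| ^ 5 := by
    intro θ
    by_cases hθ : θ ∈ Set.Ioo (-ε) ε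
    · obtain ⟨h1, h2⟩ := hball (by simpa [abs_lt] using hθ : dist θ 0 < ε)
      obtain ⟨l, hl, hlw⟩ :=
        exists_quadratic_root_near (tr θ) (dt θ) (w θ) (by positivity : 0 < k / 4) h1
      refine ⟨l, fun _ => ⟨hl, hlw.trans ?_⟩⟩
      rw [norm_pow, Real.norm_eq_abs] at h2
      rw [div_mul_eq_mul_div]
      gcongr
    · exact ⟨0, fun h => absurd h hθ⟩
  choose lam hlam using hex
  refine ⟨ε, hε, C / (k / 4), by positivity, lam, fun θ hθ => ?_⟩
  obtain ⟨h1, h2⟩ := hlam θ hθ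
  refine ⟨by rw [hdet, h1], ?_⟩
  rw [sub_sub]
  exact h2
end

section
/- Let ν ∈ (0,1), R > 0, and set S = 18/(−ν² + ν + 2) − R, T = (1/18)·( 9 − (ν+1)·R·((ν−2)·R + 6) ), and U = (1/18)·( −(ν−2)(ν+1)·R² − 6(ν+4)·R + 9(ν−14)/(ν−2) ). Then det( A(ν,θ;R,S,T,U) − e^{−Iνθ}·Id ) = O(θ⁵) as θ → 0, i.e., the principal eigenvalue of A agrees with e^{−Iνθ} to fourth order in θ. -/
open Complex Matrix

open Asymptotics Filter Topology in
theorem isBigO_sum_mul_exp_of_moments_eq_zero {ι : Type*} [Fintype ι] (n : ℕ) (a c : ι → ℂ)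
    (h : ∀ k < n, ∑ j, a j * c j ^ k = 0) :
    (fun θ : ℝ => ∑ j, a j * Complex.exp (c j * (θ : ℂ))) =O[𝓝 0] fun θ : ℝ => θ ^ n := by
  have hsum (θ : ℝ) : ∑ j, a j * Complex.exp (c j * (θ : ℂ)) =
      ∑ j, a j * (Complex.exp (c j * (θ : ℂ)) -
        ∑ k ∈ Finset.range n, (c j * (θ : ℂ)) ^ k / (k.factorial : ℂ)) := by
    have hpoly : ∑ j, a j * ∑ k ∈ Finset.range n, (c j * (θ : ℂ)) ^ k / (k.factorial : ℂ) = 0 := by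
      simp_rw [Finset.mul_sum]
      rw [Finset.sum_comm]
      refine Finset.sum_eq_zero fun k hk => ?_
      calc ∑ j, a j * ((c j * (θ : ℂ)) ^ k / (k.factorial : ℂ))
          = (∑ j, a j * c j ^ k) * ((θ : ℂ) ^ k / (k.factorial : ℂ)) := by
            rw [Finset.sum_mul]
            exact Finset.sum_congr rfl fun j _ => by ring
        _ = 0 := by rw [h k (Finset.mem_range.mp hk), zero_mul]
    simp_rw [mul_sub, Finset.sum_sub_distrib]
    rw [hpoly, sub_zero]
  simp_rw [hsum]
  refine IsBigO.fun_sum fun j _ => IsBigO.const_mul_left ?_ _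
  have hlim : Tendsto (fun θ : ℝ => c j * (θ : ℂ)) (𝓝 0) (𝓝 0) := by
    have hcont : Continuous fun θ : ℝ => c j * (θ : ℂ) := by fun_prop
    simpa using hcont.tendsto 0
  refine ((Complex.exp_sub_sum_range_isBigO_pow n).comp_tendsto hlim).trans ?_
  refine IsBigO.of_bound (‖c j‖ ^ n) (Eventually.of_forall fun θ => ?_)
  simp [mul_pow]

open Asymptotics Filter Topology in
theorem principal_eigenvalue_fourth_order_correct (ν R : ℝ)
    (hν : ν ∈ Set.Ioo (0 : ℝ) 1) (hR : 0 < R) :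
    (fun θ : ℝ => Matrix.det (ampMatrix ν θ R
        (18 / (-ν ^ 2 + ν + 2) - R)
        ((1 / 18) * (9 - (ν + 1) * R * ((ν - 2) * R + 6)))
        ((1 / 18) * (-((ν - 2) * (ν + 1) * R ^ 2) - 6 * (ν + 4) * R + 9 * (ν - 14) / (ν - 2))) -
        Complex.exp (-Complex.I * (ν : ℂ) * (θ : ℂ)) • (1 : Matrix (Fin 2) (Fin 2) ℂ)))
      =O[𝓝 0] fun θ : ℝ => θ ^ 5 := by
  obtain ⟨hν0, hν1⟩ := hν
  have h1 : (ν : ℂ) + 1 ≠ 0 := by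
    exact_mod_cast (by linarith : ν + 1 > 0).ne'
  have h2 : (ν : ℂ) - 2 ≠ 0 := by
    exact_mod_cast (by linarith : ν - 2 < 0).ne
  have hS : ((18 / (-ν ^ 2 + ν + 2) - R : ℝ) : ℂ) = -18 / (((ν : ℂ) + 1) * (ν - 2)) - R := by
    have h3 : -(ν : ℂ) ^ 2 + ν + 2 = -((ν + 1) * (ν - 2)) := by ring
    push_cast
    rw [h3, div_neg, neg_div]
  set S := 18 / (-ν ^ 2 + ν + 2) - R
  set T := (1 / 18) * (9 - (ν + 1) * R * ((ν - 2) * R + 6)) with hT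
  set U := (1 / 18) * (-((ν - 2) * (ν + 1) * R ^ 2) - 6 * (ν + 4) * R + 9 * (ν - 14) / (ν - 2))
    with hU
  let K : ℂ := ν * (1 + (1 - ν) * (U - T))
  let M : ℂ := (ν * (1 - ν)) ^ 2 * (R + S)
  let P : ℂ := (1 - ν) * (1 - ν * R)
  let Q : ℂ := ν * (1 - (1 - ν) * S)
  have key := isBigO_sum_mul_exp_of_moments_eq_zero 5
    ![(1 - K) * P + M * T, (1 - K) * Q + K * P - M * (U + T), K * Q + M * U,
      -(1 - K + P), -(K + Q), 1]
    ![0, -I, 2 * -I, ν * -I, (ν + 1) * -I, 2 * ν * -I] ?_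
  · refine key.congr_left fun θ => ?_
    have e2 : exp (2 * -I * (θ : ℂ)) = exp (-I * (θ : ℂ)) ^ 2 := by
      rw [← Complex.exp_nat_mul]; congr 1; push_cast; ring
    have e3 : exp (ν * -I * (θ : ℂ)) = exp (-I * (ν : ℂ) * (θ : ℂ)) := by
      congr 1; ring
    have e4 : exp ((ν + 1) * -I * (θ : ℂ)) =
        exp (-I * (ν : ℂ) * (θ : ℂ)) * exp (-I * (θ : ℂ)) := by
      rw [← Complex.exp_add]; congr 1; ring
    have e5 : exp (2 * ν * -I * (θ : ℂ)) = exp (-I * (ν : ℂ) * (θ : ℂ)) ^ 2 := by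
      rw [← Complex.exp_nat_mul]; congr 1; push_cast; ring
    simp only [Fin.sum_univ_six, cons_val, e2, e3, e4, e5, zero_mul, exp_zero, ampMatrix,
      det_fin_two, Matrix.sub_apply, Matrix.smul_apply, of_apply, one_apply_eq, smul_eq_mul,
      one_apply_ne, ne_eq, zero_ne_one, one_ne_zero, not_false_eq_true, K, M, P, Q]
    ring
  · have hm (k : ℕ) (hk : k < 5) : ((1 - K) * P + M * T) * 0 ^ k +
        ((1 - K) * Q + K * P - M * (U + T)) + (K * Q + M * U) * 2 ^ k - (1 - K + P) * ν ^ k -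
        (K + Q) * (ν + 1) ^ k + (2 * ν) ^ k = 0 := by
      simp only [K, M, P, Q, hS, hT, hU]
      push_cast
      interval_cases k <;> field_simp <;> ring
    intro k hk
    simp only [Fin.sum_univ_six, cons_val]
    have h0 : (0 : ℂ) ^ k = 0 ^ k * (-I) ^ k := by rw [← mul_pow, zero_mul]
    rw [h0]
    simp only [mul_pow _ (-I)]
    linear_combination (-I) ^ k * hm k hk
end

section
/- Let ν = 1/2 and R ∈ ℝ, and set S = 8 − R, T = (1/8)·(R − 2)², U = (1/8)·(R − 6)². Let q⁰, Q⁰ : ℤ → ℝ (with q⁰(i) representing the point value at interface x_{i+1/2} and Q⁰(i) the average of cell i), and define one step of the parameterized Active Flux scheme by q¹(i) = (1−ν)·q⁰(i) + ν·q⁰(i−1) − ν(1−ν)·( R·(q⁰(i) − Q⁰(i)) − S·(Q⁰(i) − q⁰(i−1)) ), F(i) = Q⁰(i) + (1−ν)·( T·(q⁰(i) − Q⁰(i)) + U·(Q⁰(i) − q⁰(i−1)) ), Q¹(i) = Q⁰(i) − ν·( F(i) − F(i−1) ); let (q², Q²) be the result of applying the same step to (q¹, Q¹). Then for all i ∈ ℤ: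 q²(i) = q⁰(i−1) and Q²(i) = Q⁰(i−1), i.e., two time steps of the scheme shift the data exactly by one cell, so the scheme is exact for ν = 1/2. -/
/-- One step of the parameterized Active Flux scheme on an infinite uniform grid:
`q i` is the point value at interface `x_{i+1/2}`, `Q i` the average of cell `i`.
Returns the pair (updated point values, updated cell averages). -/
noncomputable def afStep (ν R S T U : ℝ) (q Q : ℤ → ℝ) : (ℤ → ℝ) × (ℤ → ℝ) :=
  let F : ℤ → ℝ := fun i => Q i + (1 - ν) * (T * (q i - Q i) + U * (Q i - q (i - 1)))
  (fun i => (1 - ν) * q i + ν * q (i - 1) -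
      ν * (1 - ν) * (R * (q i - Q i) - S * (Q i - q (i - 1))),
   fun i => Q i - ν * (F i - F (i - 1)))

theorem two_steps_exact_shift (R : ℝ) (q0 Q0 : ℤ → ℝ) :
    let ν : ℝ := 1 / 2
    let S : ℝ := 8 - R
    let T : ℝ := (1 / 8) * (R - 2) ^ 2
    let U : ℝ := (1 / 8) * (R - 6) ^ 2
    let step1 := afStep ν R S T U q0 Q0
    let step2 := afStep ν R S T U step1.1 step1.2
    ∀ i : ℤ, step2.1 i = q0 (i - 1) ∧ step2.2 i = Q0 (i - 1) := by
  intro ν S T U step1 step2 i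
  simp only [step2, step1, U, T, S, ν, afStep]
  constructor <;> ring
end

section
/- Let ν = 1/2, R ∈ ℝ, and set S = 8 − R, T = (1/8)·(R − 2)², U = (1/8)·(R − 6)². Then for every θ ∈ ℝ, both e^{−Iθ/2} and −e^{−Iθ/2} are eigenvalues of the amplification matrix A(1/2, θ; R, S, T, U), i.e., det( A − e^{−Iθ/2}·Id ) = 0 and det( A + e^{−Iθ/2}·Id ) = 0. -/
open Complex Matrix

theorem eigenvalues_exact_at_half (R θ : ℝ) :
    Matrix.det (ampMatrix (1 / 2) θ R (8 - R) ((1 / 8) * (R - 2) ^ 2) ((1 / 8) * (R - 6) ^ 2) -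
        Complex.exp (-Complex.I * (θ : ℂ) / 2) • (1 : Matrix (Fin 2) (Fin 2) ℂ)) = 0 ∧
    Matrix.det (ampMatrix (1 / 2) θ R (8 - R) ((1 / 8) * (R - 2) ^ 2) ((1 / 8) * (R - 6) ^ 2) +
        Complex.exp (-Complex.I * (θ : ℂ) / 2) • (1 : Matrix (Fin 2) (Fin 2) ℂ)) = 0 := by
  have hsq : Complex.exp (-Complex.I * (θ : ℂ)) = Complex.exp (-Complex.I * (θ : ℂ) / 2) ^ 2 := by
    rw [← Complex.exp_nat_mul]
    congr 1
    push_cast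
    ring
  constructor <;>
  · simp only [ampMatrix, hsq, Matrix.det_fin_two, Matrix.sub_apply, Matrix.add_apply,
      Matrix.smul_apply, Matrix.one_apply, Matrix.of_apply, Matrix.cons_val', Matrix.cons_val_zero,
      Matrix.cons_val_one, Matrix.cons_val_fin_one, smul_eq_mul]
    push_cast
    norm_num
    ring
end

section
/- Let ν ∈ (0,1) and θ ∈ ℝ. For R, S > 0 let T(R,S) = −(1/3)(ν+1)R + R²/(R+S) + 1/2 and U(R,S) = (1/6)·( 2S·(ν − 3R/(R+S) + 1) + 3 ). If R, S, R', S' > 0 satisfy R + S = R' + S', then the amplification matrices A(ν,θ;R,S,T(R,S),U(R,S)) and A(ν,θ;R',S',T(R',S'),U(R',S')) have the same trace and the same determinant, hence the same characteristic polynomial and the same eigenvalues. That is, under the third-order conditions the eigenvalues depend on R and S only through R + S. -/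
open Complex Matrix

/-- Under the third-order conditions, written without division, the trace of the amplification
matrix is a function of `R + S`. -/
theorem ampMatrix_trace_of_third_order {ν R S T U : ℝ} (θ : ℝ)
    (hU : U = T + (ν + 1) / 3 * (R + S) - R) :
    (ampMatrix ν θ R S T U).trace =
      2 * (1 - ν * (1 - exp (-I * θ)))
        - ν * (1 - ν) * ((ν + 1) / 3 * (1 - exp (-I * θ)) + exp (-I * θ)) * (R + S : ℝ) := by
  subst hU
  simp only [ampMatrix, trace_fin_two_of]
  push_cast
  ring

/-- Under the third-order conditions, written without division, the determinant of the
amplification matrix is a function of `R + S`. -/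
theorem ampMatrix_det_of_third_order {ν R S T U : ℝ} (θ : ℝ)
    (hU : U = T + (ν + 1) / 3 * (R + S) - R)
    (hT : T * (R + S) = -(1 / 3) * (ν + 1) * R * (R + S) + R ^ 2 + (R + S) / 2) :
    (ampMatrix ν θ R S T U).det =
      (1 - ν * (1 - exp (-I * θ))
          - ν * (1 - ν) * (1 - exp (-I * θ)) * ((ν + 1) / 3) * (R + S : ℝ)) *
        (1 - ν * (1 - exp (-I * θ)) - ν * (1 - ν) * exp (-I * θ) * (R + S : ℝ))
      - (ν * (1 - ν)) ^ 2 * (R + S : ℝ) * (1 - exp (-I * θ)) *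
        (-(1 - exp (-I * θ)) / 2 + (ν + 1) / 3 * (R + S : ℝ) * exp (-I * θ)) := by
  subst hU
  have hT' := congrArg (fun x : ℝ => (x : ℂ)) hT
  simp only [ampMatrix, det_fin_two_of]
  push_cast at hT' ⊢
  linear_combination ((ν : ℂ) * (1 - ν) * (1 - exp (-I * θ))) ^ 2 * hT'

theorem third_order_eigenvalues_depend_only_on_sum (ν θ R S R' S' : ℝ)
    (hν : ν ∈ Set.Ioo (0 : ℝ) 1) (hR : 0 < R) (hS : 0 < S) (hR' : 0 < R') (hS' : 0 < S')
    (hsum : R + S = R' + S') :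
    letI T : ℝ → ℝ → ℝ := fun r s => -(1 / 3) * (ν + 1) * r + r ^ 2 / (r + s) + 1 / 2
    letI U : ℝ → ℝ → ℝ := fun r s => (1 / 6) * (2 * s * (ν - 3 * r / (r + s) + 1) + 3)
    letI A₁ := ampMatrix ν θ R S (T R S) (U R S)
    letI A₂ := ampMatrix ν θ R' S' (T R' S') (U R' S')
    Matrix.trace A₁ = Matrix.trace A₂ ∧
    Matrix.det A₁ = Matrix.det A₂ ∧
    A₁.charpoly = A₂.charpoly ∧
    ∀ lam : ℂ,
      Matrix.det (A₁ - lam • (1 : Matrix (Fin 2) (Fin 2) ℂ)) = 0 ↔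
      Matrix.det (A₂ - lam • (1 : Matrix (Fin 2) (Fin 2) ℂ)) = 0 := by
  set T : ℝ → ℝ → ℝ := fun r s => -(1 / 3) * (ν + 1) * r + r ^ 2 / (r + s) + 1 / 2
  set U : ℝ → ℝ → ℝ := fun r s => (1 / 6) * (2 * s * (ν - 3 * r / (r + s) + 1) + 3)
  set A₁ := ampMatrix ν θ R S (T R S) (U R S)
  set A₂ := ampMatrix ν θ R' S' (T R' S') (U R' S')
  have hU (r s : ℝ) (h : r + s ≠ 0) : U r s = T r s + (ν + 1) / 3 * (r + s) - r := by
    simp only [T, U]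
    field_simp
    ring
  have hT (r s : ℝ) (h : r + s ≠ 0) :
      T r s * (r + s) = -(1 / 3) * (ν + 1) * r * (r + s) + r ^ 2 + (r + s) / 2 := by
    simp only [T]
    field_simp
  have h₁ : R + S ≠ 0 := by positivity
  have h₂ : R' + S' ≠ 0 := by positivity
  have htr : A₁.trace = A₂.trace := by
    rw [ampMatrix_trace_of_third_order θ (hU R S h₁),
      ampMatrix_trace_of_third_order θ (hU R' S' h₂), hsum]
  have hdet : A₁.det = A₂.det := by
    rw [ampMatrix_det_of_third_order θ (hU R S h₁) (hT R S h₁),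
      ampMatrix_det_of_third_order θ (hU R' S' h₂) (hT R' S' h₂), hsum]
  refine ⟨htr, hdet, by rw [charpoly_fin_two, charpoly_fin_two, htr, hdet], fun lam => ?_⟩
  have hshift (A : Matrix (Fin 2) (Fin 2) ℂ) :
      (A - lam • (1 : Matrix (Fin 2) (Fin 2) ℂ)).det = lam ^ 2 - A.trace * lam + A.det := by
    simp [det_fin_two, trace_fin_two]
    ring
  rw [hshift, hshift, htr, hdet]
end

section
/- Let ν ∈ (0,1) and θ ∈ ℝ. For R ∈ ℝ let S(R) = 18/(−ν² + ν + 2) − R, T(R) = (1/18)·( 9 − (ν+1)·R·((ν−2)·R + 6) ), U(R) = (1/18)·( −(ν−2)(ν+1)·R² − 6(ν+4)·R + 9(ν−14)/(ν−2) ). Then for any R, R' ∈ ℝ, the amplification matrices A(ν,θ;R,S(R),T(R),U(R)) and A(ν,θ;R',S(R'),T(R'),U(R')) have the same trace and the same determinant, hence the same characteristic polynomial and the same eigenvalues. That is, under the fourth-order conditions the eigenvalues of the amplification matrix do not depend on the choice of R. -/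
open Complex Matrix

theorem Matrix.det_sub_smul_one_fin_two {K : Type*} [CommRing K]
    (M : Matrix (Fin 2) (Fin 2) K) (x : K) :
    (M - x • (1 : Matrix (Fin 2) (Fin 2) K)).det = x ^ 2 - M.trace * x + M.det := by
  simp [Matrix.det_fin_two, Matrix.trace_fin_two]
  ring

theorem Matrix.spectral_data_eq_of_trace_eq_of_det_eq {K : Type*} [CommRing K] [Nontrivial K]
    {M N : Matrix (Fin 2) (Fin 2) K} (htr : M.trace = N.trace) (hdet : M.det = N.det) :
    M.trace = N.trace ∧ M.det = N.det ∧ M.charpoly = N.charpoly ∧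
      ∀ x : K, (M - x • (1 : Matrix (Fin 2) (Fin 2) K)).det = 0 ↔
        (N - x • (1 : Matrix (Fin 2) (Fin 2) K)).det = 0 := by
  refine ⟨htr, hdet, ?_, fun x => ?_⟩
  · rw [Matrix.charpoly_fin_two, Matrix.charpoly_fin_two, htr, hdet]
  · rw [Matrix.det_sub_smul_one_fin_two, Matrix.det_sub_smul_one_fin_two, htr, hdet]

theorem fourth_order_eigenvalues_independent_of_R (ν θ R R' : ℝ)
    (hν : ν ∈ Set.Ioo (0 : ℝ) 1) :
    letI S : ℝ → ℝ := fun r => 18 / (-ν ^ 2 + ν + 2) - r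
    letI T : ℝ → ℝ := fun r => (1 / 18) * (9 - (ν + 1) * r * ((ν - 2) * r + 6))
    letI U : ℝ → ℝ := fun r =>
      (1 / 18) * (-((ν - 2) * (ν + 1) * r ^ 2) - 6 * (ν + 4) * r + 9 * (ν - 14) / (ν - 2))
    letI A₁ := ampMatrix ν θ R (S R) (T R) (U R)
    letI A₂ := ampMatrix ν θ R' (S R') (T R') (U R')
    Matrix.trace A₁ = Matrix.trace A₂ ∧
    Matrix.det A₁ = Matrix.det A₂ ∧
    A₁.charpoly = A₂.charpoly ∧
    ∀ lam : ℂ,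
      Matrix.det (A₁ - lam • (1 : Matrix (Fin 2) (Fin 2) ℂ)) = 0 ↔
      Matrix.det (A₂ - lam • (1 : Matrix (Fin 2) (Fin 2) ℂ)) = 0 := by
  have h₁ : (ν : ℂ) - 2 ≠ 0 := by
    have : ν - 2 ≠ 0 := (by linarith [hν.2] : ν - 2 < 0).ne
    exact_mod_cast this
  have h₂ : (ν : ℂ) + 1 ≠ 0 := by
    have : ν + 1 ≠ 0 := (by linarith [hν.1] : 0 < ν + 1).ne'
    exact_mod_cast this
  have h₃ : -(ν : ℂ) ^ 2 + ν + 2 = -((ν - 2) * (ν + 1)) := by ring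
  refine Matrix.spectral_data_eq_of_trace_eq_of_det_eq ?_ ?_
  · simp only [ampMatrix, Matrix.trace_fin_two_of]
    push_cast
    ring
  · simp only [ampMatrix, Matrix.det_fin_two_of]
    push_cast
    rw [h₃]
    field_simp
    ring
end
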